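/- Let x : [0,∞) → ℝᵐ be a differentiable solution of the disturbed dynamical system ẋ(t) = A(t, x(t)) x(t) + d(t). Suppose V : ℝᵐ → ℝ is differentiable and there exist positive constants α₁, α₂, α₃, α₄ such that for all z ∈ ℝᵐ and t ≥ 0: α₁‖z‖² ≤ V(z) ≤ α₂‖z‖², ⟨∇V(z), A(t,z)z⟩ ≤ −α₃‖z‖², and |⟨∇V(z), d(t)⟩| ≤ α₄‖z‖. Then for all t ≥ 0, ‖x(t)‖ ≤ √(α₂/α₁)·e^{−(α₃/(2α₂))t}·‖x(0)‖ + α₂α₄/(α₁α₃); in particular, limsup_{t→∞} ‖x(t)‖ ≤ α₂α₄/(α₁α₃). -/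

import Mathlib

open Filter RealInnerProductSpace

/-- A Grönwall-type bound: if `v ≥ 0` satisfies `v' ≤ -2 c v + 2 k √v`, then `√v` decays
exponentially to the level `k / c`. -/
theorem sqrt_le_exp_mul_sqrt_add_of_hasDerivAt {c k : ℝ} (hc : 0 < c) (hk : 0 ≤ k) {v v' : ℝ → ℝ}
    (hv : ∀ t ≥ (0 : ℝ), HasDerivAt v (v' t) t) (hv0 : ∀ t, 0 ≤ v t)
    (hv' : ∀ t ≥ (0 : ℝ), v' t ≤ -(2 * c) * v t + 2 * k * √(v t)) {t : ℝ} (ht : 0 ≤ t) :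
    √(v t) ≤ Real.exp (-c * t) * √(v 0) + k / c := by
  refine le_of_forall_pos_le_add fun δ hδ => ?_
  obtain ⟨ε, hε, rfl⟩ : ∃ ε > 0, δ = 2 * ε := ⟨δ / 2, by positivity, by ring⟩
  have hpos (s : ℝ) : 0 < v s + ε ^ 2 := by have := hv0 s; positivity
  have hderiv (s : ℝ) (hs : 0 ≤ s) : HasDerivAt
      (fun s => Real.exp (c * s) * (√(v s + ε ^ 2) - (ε + k / c)))
      (Real.exp (c * s) * (c * 1) * (√(v s + ε ^ 2) - (ε + k / c)) +
        Real.exp (c * s) * (v' s / (2 * √(v s + ε ^ 2)))) s :=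
    ((hasDerivAt_id s).const_mul c).exp.mul
      ((((hv s hs).add_const (ε ^ 2)).sqrt (hpos s).ne').sub_const _)
  have hanti : AntitoneOn (fun s => Real.exp (c * s) * (√(v s + ε ^ 2) - (ε + k / c)))
      (Set.Ici 0) := by
    refine antitoneOn_of_deriv_nonpos (convex_Ici 0)
      (fun s hs => (hderiv s hs).continuousAt.continuousWithinAt) ?_ ?_
    · intro s hs
      rw [interior_Ici] at hs
      exact (hderiv s (le_of_lt hs)).differentiableAt.differentiableWithinAt
    · intro s hs
      rw [interior_Ici] at hs
      have hs : 0 ≤ s := le_of_lt hs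
      rw [(hderiv s hs).deriv]
      have hu : 0 < √(v s + ε ^ 2) := Real.sqrt_pos.2 (hpos s)
      have hu2 : √(v s + ε ^ 2) ^ 2 = v s + ε ^ 2 := Real.sq_sqrt (hpos s).le
      have hvu : √(v s) ≤ √(v s + ε ^ 2) := Real.sqrt_le_sqrt (by linarith [sq_nonneg ε])
      have hεu : ε ≤ √(v s + ε ^ 2) := Real.le_sqrt_of_sq_le (by linarith [hv0 s])
      have hb := hv' s hs
      set u := √(v s + ε ^ 2)
      have hquot : v' s / (2 * u) ≤ -c * u + c * ε + k := by
        rw [div_le_iff₀ (by positivity)]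
        have h1 : k * √(v s) ≤ k * u := by gcongr
        have h2 : c * ε * ε ≤ c * ε * u := by gcongr
        have h3 : v s = u ^ 2 - ε ^ 2 := by linarith
        rw [h3] at hb h1
        nlinarith
      have hck : c * (k / c) = k := by field_simp
      have : c * 1 * (u - (ε + k / c)) + v' s / (2 * u) ≤ 0 := by linarith
      calc _ = Real.exp (c * s) * (c * 1 * (u - (ε + k / c)) + v' s / (2 * u)) := by ring
        _ ≤ 0 := mul_nonpos_of_nonneg_of_nonpos (Real.exp_pos _).le this
  have hle := hanti (Set.mem_Ici.2 le_rfl) (Set.mem_Ici.2 ht) ht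
  simp only [mul_zero, Real.exp_zero, one_mul] at hle
  have hu0 : √(v 0 + ε ^ 2) ≤ √(v 0) + ε := by
    rw [Real.sqrt_le_left (by positivity)]
    nlinarith [Real.sq_sqrt (hv0 0), Real.sqrt_nonneg (v 0)]
  have hee : Real.exp (-c * t) * Real.exp (c * t) = 1 := by
    rw [← Real.exp_add]; simp
  have hkc : 0 ≤ k / c := by positivity
  have hmul : √(v t + ε ^ 2) - (ε + k / c) ≤ Real.exp (-c * t) * √(v 0) := by
    calc √(v t + ε ^ 2) - (ε + k / c)
        = Real.exp (-c * t) * (Real.exp (c * t) * (√(v t + ε ^ 2) - (ε + k / c))) := by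
          rw [← mul_assoc, hee, one_mul]
      _ ≤ Real.exp (-c * t) * √(v 0) := by gcongr; linarith
  have hvt : √(v t) ≤ √(v t + ε ^ 2) := Real.sqrt_le_sqrt (by linarith [sq_nonneg ε])
  linarith

/-- Bound on the response of a disturbed dynamical system
`ẋ = A(t,x)x + d(t)` admitting a quadratic Lyapunov function for the undisturbed system. -/
theorem disturbed_lyapunov_bound (m : ℕ) (α₁ α₂ α₃ α₄ : ℝ)
    (hα₁ : 0 < α₁) (hα₂ : 0 < α₂) (hα₃ : 0 < α₃) (hα₄ : 0 < α₄)
    (A : ℝ → EuclideanSpace ℝ (Fin m) → (EuclideanSpace ℝ (Fin m) →L[ℝ] EuclideanSpace ℝ (Fin m)))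
    (d : ℝ → EuclideanSpace ℝ (Fin m))
    (x : ℝ → EuclideanSpace ℝ (Fin m))
    (V : EuclideanSpace ℝ (Fin m) → ℝ)
    (hx : ∀ t ≥ (0 : ℝ), HasDerivAt x (A t (x t) (x t) + d t) t)
    (hV : Differentiable ℝ V)
    (hVlb : ∀ z, α₁ * ‖z‖ ^ 2 ≤ V z)
    (hVub : ∀ z, V z ≤ α₂ * ‖z‖ ^ 2)
    (hdecay : ∀ t ≥ (0 : ℝ), ∀ z, ⟪gradient V z, A t z z⟫ ≤ -α₃ * ‖z‖ ^ 2)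
    (hdist : ∀ t ≥ (0 : ℝ), ∀ z, |⟪gradient V z, d t⟫| ≤ α₄ * ‖z‖) :
    (∀ t ≥ (0 : ℝ),
        ‖x t‖ ≤ Real.sqrt (α₂ / α₁) * Real.exp (-(α₃ / (2 * α₂)) * t) * ‖x 0‖
          + α₂ * α₄ / (α₁ * α₃))
      ∧ limsup (fun t => ‖x t‖) atTop ≤ α₂ * α₄ / (α₁ * α₃) := by
  have hbound : ∀ t ≥ (0 : ℝ),
      ‖x t‖ ≤ √(α₂ / α₁) * Real.exp (-(α₃ / (2 * α₂)) * t) * ‖x 0‖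
        + α₂ * α₄ / (α₁ * α₃) := by
    intro t ht
    have hs : 0 < √α₁ := Real.sqrt_pos.2 hα₁
    have hs2 : √α₁ ^ 2 = α₁ := Real.sq_sqrt hα₁.le
    have hV0 (z) : 0 ≤ V z := le_trans (by positivity) (hVlb z)
    have hnorm (z) : √α₁ * ‖z‖ ≤ √(V z) := by
      refine Real.le_sqrt_of_sq_le ?_
      rw [mul_pow, hs2]
      exact hVlb z
    have hder (s : ℝ) (h0 : s ≥ 0) : HasDerivAt (fun s => V (x s))
        ⟪gradient V (x s), A s (x s) (x s) + d s⟫ s := by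
      rw [← InnerProductSpace.toDual_apply_apply]
      exact (hV (x s)).hasGradientAt.hasFDerivAt.comp_hasDerivAt s (hx s h0)
    have key := sqrt_le_exp_mul_sqrt_add_of_hasDerivAt (c := α₃ / (2 * α₂))
      (k := α₄ / (2 * √α₁)) (by positivity) (by positivity) hder (fun s => hV0 (x s))
      (fun s h0 => ?_) ht
    · have h0 : √(V (x 0)) ≤ √α₂ * ‖x 0‖ := by
        rw [Real.sqrt_le_left (by positivity), mul_pow, Real.sq_sqrt hα₂.le]
        exact hVub _
      have hscaled : √α₁ * ‖x t‖ ≤ Real.exp (-(α₃ / (2 * α₂)) * t) * (√α₂ * ‖x 0‖)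
          + α₄ / (2 * √α₁) / (α₃ / (2 * α₂)) :=
        (hnorm _).trans (key.trans (by gcongr))
      calc ‖x t‖ = √α₁ * ‖x t‖ / √α₁ := by field_simp
        _ ≤ (Real.exp (-(α₃ / (2 * α₂)) * t) * (√α₂ * ‖x 0‖)
            + α₄ / (2 * √α₁) / (α₃ / (2 * α₂))) / √α₁ := by gcongr
        _ = √α₂ / √α₁ * Real.exp (-(α₃ / (2 * α₂)) * t) * ‖x 0‖
            + α₂ * α₄ / (√α₁ ^ 2 * α₃) := by
          rw [add_div]
          congr 1
          · ring
          · field_simp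
        _ = _ := by rw [hs2, Real.sqrt_div hα₂.le]
    · have h1 := hdecay s h0 (x s)
      have h2 := (le_abs_self _).trans (hdist s h0 (x s))
      have h3 : α₃ / α₂ * V (x s) ≤ α₃ * ‖x s‖ ^ 2 := by
        calc α₃ / α₂ * V (x s) ≤ α₃ / α₂ * (α₂ * ‖x s‖ ^ 2) := by gcongr; exact hVub _
          _ = α₃ * ‖x s‖ ^ 2 := by field_simp
      have h4 : α₄ * ‖x s‖ ≤ α₄ / √α₁ * √(V (x s)) := by
        calc α₄ * ‖x s‖ = α₄ / √α₁ * (√α₁ * ‖x s‖) := by field_simp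
          _ ≤ _ := by gcongr; exact hnorm _
      have h5 : 2 * (α₃ / (2 * α₂)) = α₃ / α₂ := by field_simp
      have h6 : 2 * (α₄ / (2 * √α₁)) = α₄ / √α₁ := by field_simp
      rw [inner_add_right, h5, h6]
      linarith
  refine ⟨hbound, ?_⟩
  have hlim : Tendsto (fun t => √(α₂ / α₁) * Real.exp (-(α₃ / (2 * α₂)) * t) * ‖x 0‖
      + α₂ * α₄ / (α₁ * α₃)) atTop (nhds (α₂ * α₄ / (α₁ * α₃))) := by
    have hexp : Tendsto (fun t => Real.exp (-(α₃ / (2 * α₂)) * t)) atTop (nhds 0) :=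
      Real.tendsto_exp_atBot.comp
        (tendsto_id.const_mul_atTop_of_neg (neg_neg_of_pos (by positivity)))
    simpa using ((hexp.const_mul √(α₂ / α₁)).mul_const ‖x 0‖).add_const (α₂ * α₄ / (α₁ * α₃))
  rw [← hlim.limsup_eq]
  exact limsup_le_limsup ((eventually_ge_atTop 0).mono hbound)
    (isCoboundedUnder_le_of_le atTop fun t => norm_nonneg (x t)) hlim.isBoundedUnder_le
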